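/- arXiv:1812.10013 — 5 statements merged into one kernel-verified Lean document; each statement's English description precedes it below -/
import Mathlib

section
/- Fix constants c1 > 0 and ζ ∈ (0,1). There exist constants C > 0 and τ > 0 (depending only on c1 and ζ) such that for all n and all sparsity levels s with 2 < s ≤ ζ·n, the minimax expected number of false positives over rate-minimax estimators satisfies inf_{β̂ ∈ Ω_o(c1)} sup_{β ∈ B(n,s)} E_β[FP(β̂)] ≥ C·s·(s/n)^τ − s^{−1/8}. -/
open MeasureTheory ProbabilityTheory Filter
open scoped ENNReal

/-- Normal means model: `y = β + ε` with `ε ~ N(0, I_n)`, i.e. the law of `y`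
is the product of the Gaussians `N(β i, 1)`. -/
noncomputable def stdNormalMeans (n : ℕ) (β : Fin n → ℝ) : Measure (Fin n → ℝ) :=
  Measure.pi fun i => gaussianReal (β i) 1

/-- `B(n,s)`: vectors in `ℝ^n` with at most `s` nonzero coordinates. -/
def Sparse (n s : ℕ) : Set (Fin n → ℝ) := {β | {i | β i ≠ 0}.ncard ≤ s}

/-- Number of false positives of the estimate `b` when the truth is `β`. -/
noncomputable def FPcount {n : ℕ} (b β : Fin n → ℝ) : ℕ :=
  {i | b i ≠ 0 ∧ β i = 0}.ncard

/-- Number of true positives of the estimate `b` when the truth is `β`. -/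
noncomputable def TPcount {n : ℕ} (b β : Fin n → ℝ) : ℕ :=
  {i | b i ≠ 0 ∧ β i ≠ 0}.ncard

/-- Expected number of false positives `E_β[FP(β̂)]`. -/
noncomputable def expFP (n : ℕ) (bh : (Fin n → ℝ) → Fin n → ℝ) (β : Fin n → ℝ) : ℝ≥0∞ :=
  ∫⁻ y, (FPcount (bh y) β : ℝ≥0∞) ∂(stdNormalMeans n β)

/-- `L²` risk `E_β ‖β̂ − β‖²`. -/
noncomputable def l2risk (n : ℕ) (bh : (Fin n → ℝ) → Fin n → ℝ) (β : Fin n → ℝ) : ℝ≥0∞ :=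
  ∫⁻ y, ENNReal.ofReal (∑ i, (bh y i - β i) ^ 2) ∂(stdNormalMeans n β)

/-- Membership in `Ω_o(c1)`: a measurable estimator whose worst-case risk over
`B(n,s)` is at most `c1 · s · log(n/s)`. -/
def RateMinimax (n s : ℕ) (c1 : ℝ) (bh : (Fin n → ℝ) → Fin n → ℝ) : Prop :=
  Measurable bh ∧
    ∀ β ∈ Sparse n s, l2risk n bh β ≤ ENNReal.ofReal (c1 * s * Real.log ((n : ℝ) / s))

/-- A Gaussian with mean `b` is dominated by a mixture of the Gaussians with means `2b` and `0`. -/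
lemma gaussianReal_le_add (b : ℝ) :
    gaussianReal b 1 ≤ ENNReal.ofReal (1 / 4) • gaussianReal (2 * b) 1 +
      ENNReal.ofReal (Real.exp (b ^ 2)) • gaussianReal 0 1 := by
  simp only [gaussianReal_of_var_ne_zero _ one_ne_zero]
  rw [← withDensity_smul _ (measurable_gaussianPDF _ _),
    ← withDensity_smul _ (measurable_gaussianPDF _ _),
    ← withDensity_add_left ((measurable_gaussianPDF _ _).const_smul _)]
  refine withDensity_mono (ae_of_all _ fun x => ?_)
  simp only [Pi.add_apply, Pi.smul_apply, smul_eq_mul, gaussianPDF]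
  rw [← ENNReal.ofReal_mul (by norm_num), ← ENNReal.ofReal_mul (Real.exp_nonneg _),
    ← ENNReal.ofReal_add (by have := gaussianPDFReal_nonneg (2 * b) 1 x; positivity)
      (by have := gaussianPDFReal_nonneg 0 1 x; positivity)]
  refine ENNReal.ofReal_le_ofReal ?_
  simp only [gaussianPDFReal]
  set c : ℝ := (√(2 * Real.pi * ((1 : NNReal) : ℝ)))⁻¹
  have hc : 0 ≤ c := by positivity
  have h2 : Real.exp (-(x - b) ^ 2 / (2 * ((1 : NNReal) : ℝ))) =
      Real.exp (-(x - 2 * b) ^ 2 / 4) * Real.exp ((b ^ 2 + -(x - 0) ^ 2 / 2) / 2) := by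
    rw [← Real.exp_add]; congr 1; push_cast; ring
  have h3 : Real.exp (-(x - 2 * b) ^ 2 / (2 * ((1 : NNReal) : ℝ))) =
      Real.exp (-(x - 2 * b) ^ 2 / 4) ^ 2 := by
    rw [← Real.exp_nat_mul]; congr 1; push_cast; ring
  have h4 : Real.exp (b ^ 2) * Real.exp (-(x - 0) ^ 2 / (2 * ((1 : NNReal) : ℝ))) =
      Real.exp ((b ^ 2 + -(x - 0) ^ 2 / 2) / 2) ^ 2 := by
    rw [← Real.exp_nat_mul, ← Real.exp_add]; congr 1; push_cast; ring
  rw [mul_left_comm (Real.exp (b ^ 2)) c, h4, h2, h3]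
  nlinarith [mul_nonneg hc (sq_nonneg (1 / 2 * Real.exp (-(x - 2 * b) ^ 2 / 4) -
    Real.exp ((b ^ 2 + -(x - 0) ^ 2 / 2) / 2)))]

instance isProbabilityMeasure_stdNormalMeans (n : ℕ) (β : Fin n → ℝ) :
    IsProbabilityMeasure (stdNormalMeans n β) := by
  unfold stdNormalMeans; infer_instance

lemma stdNormalMeans_update_apply {m : ℕ} (β : Fin (m + 1) → ℝ) (i : Fin (m + 1)) (b : ℝ)
    {E : Set (Fin (m + 1) → ℝ)} (hE : MeasurableSet E) :
    stdNormalMeans (m + 1) (Function.update β i b) E =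
      ∫⁻ x, (Measure.pi fun j => gaussianReal (β (i.succAbove j)) 1)
        {z | i.insertNth x z ∈ E} ∂(gaussianReal b 1) := by
  have h := (measurePreserving_piFinSuccAbove
    (fun j => gaussianReal (Function.update β i b j) 1) i).symm
  simp only [Function.update_self, Fin.succAbove_ne, ne_eq, not_false_eq_true,
    Function.update_of_ne] at h
  rw [stdNormalMeans, ← h.measure_preimage hE.nullMeasurableSet,
    Measure.prod_apply (h.measurable hE)]
  rfl

lemma stdNormalMeans_update_le {n : ℕ} (β : Fin n → ℝ) (i : Fin n) (b : ℝ)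
    {E : Set (Fin n → ℝ)} (hE : MeasurableSet E) :
    (stdNormalMeans n (Function.update β i b)).real E ≤
      1 / 4 + Real.exp (b ^ 2) * (stdNormalMeans n (Function.update β i 0)).real E := by
  cases n with
  | zero => exact i.elim0
  | succ m =>
    have h : stdNormalMeans (m + 1) (Function.update β i b) E ≤
        ENNReal.ofReal (1 / 4) * stdNormalMeans (m + 1) (Function.update β i (2 * b)) E +
        ENNReal.ofReal (Real.exp (b ^ 2)) *
          stdNormalMeans (m + 1) (Function.update β i 0) E := by
      simp only [stdNormalMeans_update_apply β i _ hE]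
      refine (lintegral_mono' (gaussianReal_le_add b) le_rfl).trans_eq ?_
      simp only [lintegral_add_measure, lintegral_smul_measure, smul_eq_mul]
    have h2 : stdNormalMeans (m + 1) (Function.update β i b) E ≤
        ENNReal.ofReal (1 / 4 + Real.exp (b ^ 2) *
          (stdNormalMeans (m + 1) (Function.update β i 0)).real E) := by
      rw [ENNReal.ofReal_add (by norm_num) (by positivity),
        ENNReal.ofReal_mul (Real.exp_nonneg _), ofReal_measureReal]
      exact h.trans (by gcongr; exact mul_le_of_le_one_right' prob_le_one)
    exact ENNReal.toReal_le_of_le_ofReal (by positivity) h2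

/-- The vector equal to `b` on `S` and to zero elsewhere. -/
noncomputable def spike {n : ℕ} (b : ℝ) (S : Finset (Fin n)) : Fin n → ℝ :=
  fun j => if j ∈ S then b else 0

lemma spike_mem_sparse {n s : ℕ} (b : ℝ) {S : Finset (Fin n)} (hS : S.card ≤ s) :
    spike b S ∈ Sparse n s := by
  refine (Set.ncard_le_ncard (t := (S : Set (Fin n))) ?_ S.finite_toSet).trans
    (by rwa [Set.ncard_coe_finset])
  intro j hj
  by_contra h
  exact hj (if_neg h)

lemma update_spike_erase {n : ℕ} (b : ℝ) {S : Finset (Fin n)} {i : Fin n} (hi : i ∈ S) :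
    Function.update (spike b (S.erase i)) i b = spike b S := by
  ext j
  rcases eq_or_ne j i with rfl | h
  · simp [spike, hi]
  · simp [spike, h]

lemma update_spike_erase_zero {n : ℕ} (b : ℝ) (S : Finset (Fin n)) (i : Fin n) :
    Function.update (spike b (S.erase i)) i 0 = spike b (S.erase i) := by
  simp [Function.update_eq_self_iff, spike]

lemma measurableSet_apply_ne_zero {n : ℕ} {bh : (Fin n → ℝ) → Fin n → ℝ} (hbh : Measurable bh)
    (i : Fin n) : MeasurableSet {y | bh y i ≠ 0} :=
  ((measurable_pi_apply i).comp hbh) (measurableSet_singleton 0).compl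

lemma sum_measure_le_expFP {n : ℕ} {bh : (Fin n → ℝ) → Fin n → ℝ} (hbh : Measurable bh)
    {b : ℝ} (S : Finset (Fin n)) :
    ∑ i ∈ Sᶜ, stdNormalMeans n (spike b S) {y | bh y i ≠ 0} ≤ expFP n bh (spike b S) := by
  simp only [← lintegral_indicator_one (measurableSet_apply_ne_zero hbh _)]
  rw [← lintegral_finsetSum _ fun i _ =>
    measurable_one.indicator (measurableSet_apply_ne_zero hbh i)]
  refine lintegral_mono fun y => ?_
  classical
  simp only [Set.indicator_apply, Set.mem_ofPred_eq, Pi.one_apply, Finset.sum_boole]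
  rw [FPcount, ← Set.ncard_coe_finset]
  refine Nat.cast_le.2 (Set.ncard_le_ncard (fun j hj => ?_) (Set.toFinite _))
  simp only [Finset.coe_filter, Finset.mem_compl, Set.mem_ofPred_eq] at hj
  exact ⟨hj.2, if_neg hj.1⟩

lemma sum_measure_mul_sq_le_l2risk {n : ℕ} {bh : (Fin n → ℝ) → Fin n → ℝ} (hbh : Measurable bh)
    (b : ℝ) (S : Finset (Fin n)) :
    ENNReal.ofReal (b ^ 2) * ∑ i ∈ S, stdNormalMeans n (spike b S) {y | bh y i ≠ 0}ᶜ ≤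
      l2risk n bh (spike b S) := by
  have hm i := (measurableSet_apply_ne_zero hbh i).compl
  simp only [← lintegral_indicator_one (hm _)]
  rw [← lintegral_finsetSum _ fun i _ => measurable_one.indicator (hm i),
    ← lintegral_const_mul _ (Finset.measurable_sum _ fun i _ => measurable_one.indicator (hm i))]
  refine lintegral_mono fun y => ?_
  rw [Finset.mul_sum, ENNReal.ofReal_sum_of_nonneg fun i _ => sq_nonneg _]
  refine (Finset.sum_le_sum fun i hi => ?_).trans
    (Finset.sum_le_sum_of_subset (Finset.subset_univ S))
  by_cases h : bh y i = 0
  · simp [h, spike, hi]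
  · simp [h]

lemma card_sub_le_sum_measureReal {n s : ℕ} {c1 b : ℝ} {bh : (Fin n → ℝ) → Fin n → ℝ}
    (hbh : RateMinimax n s c1 bh) (hc1 : 0 < c1) (hlog : 0 < Real.log ((n : ℝ) / s))
    (hb : b ^ 2 = 4 * c1 * Real.log ((n : ℝ) / s)) {S : Finset (Fin n)} (hS : S.card = s) :
    3 / 4 * (s : ℝ) ≤ ∑ i ∈ S, (stdNormalMeans n (spike b S)).real {y | bh y i ≠ 0} := by
  have h := (sum_measure_mul_sq_le_l2risk hbh.1 b S).trans (hbh.2 _ (spike_mem_sparse b hS.le))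
  have h' := ENNReal.toReal_mono ENNReal.ofReal_ne_top h
  rw [ENNReal.toReal_mul, ENNReal.toReal_sum fun i _ => measure_ne_top _ _,
    ENNReal.toReal_ofReal (sq_nonneg _), ENNReal.toReal_ofReal (by positivity)] at h'
  change b ^ 2 * ∑ i ∈ S, (stdNormalMeans n (spike b S)).real _ ≤ _ at h'
  simp only [probReal_compl_eq_one_sub (measurableSet_apply_ne_zero hbh.1 _)] at h'
  rw [Finset.sum_sub_distrib, Finset.sum_const, hS, hb] at h'
  simp only [nsmul_eq_mul, mul_one] at h'
  have : 0 < c1 * Real.log ((n : ℝ) / s) := by positivity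
  refine le_of_mul_le_mul_left ?_ this
  linarith

lemma sum_powersetCard_succ_sum_erase {α M : Type*} [Fintype α] [DecidableEq α]
    [AddCommMonoid M] (k : ℕ) (g : Finset α → α → M) :
    ∑ S ∈ Finset.univ.powersetCard (k + 1), ∑ i ∈ S, g (S.erase i) i =
      ∑ S ∈ Finset.univ.powersetCard k, ∑ i ∈ Sᶜ, g S i := by
  rw [Finset.sum_sigma', Finset.sum_sigma']
  refine Finset.sum_bij' (fun p _ => ⟨p.1.erase p.2, p.2⟩) (fun p _ => ⟨insert p.2 p.1, p.2⟩)
    ?_ ?_ ?_ ?_ ?_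
  · rintro ⟨S, i⟩ h
    simp only [Finset.mem_sigma, Finset.mem_powersetCard_univ] at h
    simp [Finset.card_erase_of_mem h.2, h.1]
  · rintro ⟨S, i⟩ h
    simp only [Finset.mem_sigma, Finset.mem_powersetCard_univ, Finset.mem_compl] at h
    simp [Finset.card_insert_of_notMem h.2, h.1]
  · rintro ⟨S, i⟩ h
    simp only [Finset.mem_sigma] at h
    simp [Finset.insert_erase h.2]
  · rintro ⟨S, i⟩ h
    simp only [Finset.mem_sigma, Finset.mem_compl] at h
    simp [Finset.erase_insert h.2]
  · intros; rfl

lemma sub_le_two_mul_exp_mul_of_expFP_le {n k : ℕ} {c1 b F : ℝ} {bh : (Fin n → ℝ) → Fin n → ℝ}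
    (hbh : RateMinimax n (k + 1) c1 bh) (hc1 : 0 < c1) (hkn : k ≤ n)
    (hlog : 0 < Real.log ((n : ℝ) / (k + 1 : ℕ)))
    (hb : b ^ 2 = 4 * c1 * Real.log ((n : ℝ) / (k + 1 : ℕ))) (hF0 : 0 ≤ F)
    (hF : ∀ β ∈ Sparse n (k + 1), expFP n bh β ≤ ENNReal.ofReal F) :
    (n : ℝ) - k ≤ 2 * Real.exp (b ^ 2) * F := by
  set p : Finset (Fin n) → Fin n → ℝ :=
    fun S i => (stdNormalMeans n (spike b S)).real {y | bh y i ≠ 0}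
  have hlow : (n.choose (k + 1) : ℝ) * (3 / 4 * ((k + 1 : ℕ) : ℝ)) ≤
      ∑ S ∈ Finset.univ.powersetCard (k + 1), ∑ i ∈ S, p S i := by
    have := Finset.card_nsmul_le_sum (Finset.univ.powersetCard (k + 1))
      (fun S => ∑ i ∈ S, p S i) (3 / 4 * ((k + 1 : ℕ) : ℝ)) fun S hS =>
        card_sub_le_sum_measureReal hbh hc1 hlog hb (Finset.mem_powersetCard_univ.1 hS)
    simpa using this
  have hstep : ∑ S ∈ Finset.univ.powersetCard (k + 1), ∑ i ∈ S, p S i ≤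
      ∑ S ∈ Finset.univ.powersetCard (k + 1), ∑ i ∈ S,
        (1 / 4 + Real.exp (b ^ 2) * p (S.erase i) i) := by
    refine Finset.sum_le_sum fun S _ => Finset.sum_le_sum fun i hi => ?_
    have := stdNormalMeans_update_le (spike b (S.erase i)) i b
      (measurableSet_apply_ne_zero hbh.1 i)
    rwa [update_spike_erase b hi, update_spike_erase_zero] at this
  have hup : ∑ S ∈ Finset.univ.powersetCard k, ∑ i ∈ Sᶜ,
      (1 / 4 + Real.exp (b ^ 2) * p S i) ≤
        n.choose k * (((n : ℝ) - k) * (1 / 4) + Real.exp (b ^ 2) * F) := by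
    have := Finset.sum_le_card_nsmul (Finset.univ.powersetCard k)
      (fun S : Finset (Fin n) => ∑ i ∈ Sᶜ, (1 / 4 + Real.exp (b ^ 2) * p S i))
      (((n : ℝ) - k) * (1 / 4) + Real.exp (b ^ 2) * F) fun S hS => ?_
    · simpa [mul_add] using this
    have hS := Finset.mem_powersetCard_univ.1 hS
    have h1 := (sum_measure_le_expFP hbh.1 S).trans
      (hF _ (spike_mem_sparse b (hS.le.trans k.le_succ)))
    have h2 := ENNReal.toReal_mono ENNReal.ofReal_ne_top h1
    rw [ENNReal.toReal_sum fun i _ => measure_ne_top _ _, ENNReal.toReal_ofReal hF0] at h2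
    rw [Finset.sum_add_distrib, ← Finset.mul_sum, Finset.sum_const, Finset.card_compl, hS,
      Fintype.card_fin, nsmul_eq_mul, Nat.cast_sub hkn]
    gcongr
    exact h2
  rw [sum_powersetCard_succ_sum_erase k fun S i => 1 / 4 + Real.exp (b ^ 2) * p S i] at hstep
  have hmain := hlow.trans (hstep.trans hup)
  have hch : (n.choose (k + 1) : ℝ) * ((k + 1 : ℕ) : ℝ) = n.choose k * ((n : ℝ) - k) := by
    rw [← Nat.cast_sub hkn]; exact_mod_cast Nat.choose_succ_right_eq n k
  have hpos : (0 : ℝ) < n.choose k := by exact_mod_cast Nat.choose_pos hkn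
  have : (n.choose k : ℝ) * ((n : ℝ) - k) ≤ n.choose k * (2 * Real.exp (b ^ 2) * F) := by
    linarith
  exact le_of_mul_le_mul_left this hpos

/-- Minimax lower bound on the expected number of false positives over all
rate-minimax estimators in the normal means model (Theorem 1 of the paper,
non-asymptotic form): there are constants `C, τ > 0` depending only on `c1`
and `ζ` such that for all `n` and `2 < s ≤ ζ n`,
`inf_{β̂ ∈ Ω_o(c1)} sup_{β ∈ B(n,s)} E_β[FP(β̂)] ≥ C s (s/n)^τ − s^{−1/8}`. -/
theorem minimax_FP_lower_bound (c1 ζ : ℝ) (hc1 : 0 < c1) (hζ : ζ ∈ Set.Ioo (0 : ℝ) 1) :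
    ∃ C > (0 : ℝ), ∃ τ > (0 : ℝ), ∀ n s : ℕ, 2 < s → (s : ℝ) ≤ ζ * n →
      ∀ bh : (Fin n → ℝ) → Fin n → ℝ, RateMinimax n s c1 bh →
        ENNReal.ofReal (C * s * ((s : ℝ) / n) ^ τ - (s : ℝ) ^ (-(1 / 8 : ℝ))) ≤
          ⨆ β ∈ Sparse n s, expFP n bh β := by
  obtain ⟨hζ0, hζ1⟩ := hζ
  refine ⟨(1 - ζ) / 2, by linarith, 4 * c1, by positivity, fun n s hs hsn bh hbh => ?_⟩
  by_cases htop : ⨆ β ∈ Sparse n s, expFP n bh β = ⊤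
  · rw [htop]; exact le_top
  have hs0 : (0 : ℝ) < s := by exact_mod_cast (by omega : 0 < s)
  have hn0 : (0 : ℝ) < n := pos_of_mul_pos_right (hs0.trans_le hsn) hζ0.le
  have hsltn : (s : ℝ) < n := by nlinarith
  have hlog : 0 < Real.log ((n : ℝ) / s) := Real.log_pos ((one_lt_div hs0).2 hsltn)
  refine ENNReal.ofReal_le_of_le_toReal ?_
  set F := (⨆ β ∈ Sparse n s, expFP n bh β).toReal with hFdef
  have hF : ∀ β ∈ Sparse n s, expFP n bh β ≤ ENNReal.ofReal F := fun β hβ => by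
    rw [hFdef, ENNReal.ofReal_toReal htop]
    exact le_iSup₂ (f := fun β (_ : β ∈ Sparse n s) => expFP n bh β) β hβ
  obtain ⟨k, rfl⟩ : ∃ k, s = k + 1 := ⟨s - 1, by omega⟩
  have hkn : k ≤ n := by
    have : k + 1 < n := by exact_mod_cast hsltn
    omega
  have hb : √(4 * c1 * Real.log ((n : ℝ) / (k + 1 : ℕ))) ^ 2 =
      4 * c1 * Real.log ((n : ℝ) / (k + 1 : ℕ)) := Real.sq_sqrt (by positivity)
  have h := sub_le_two_mul_exp_mul_of_expFP_le hbh hc1 hkn hlog hb ENNReal.toReal_nonneg hF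
  have hr : (((k + 1 : ℕ) : ℝ) / n) ^ (4 * c1) =
      (Real.exp (4 * c1 * Real.log ((n : ℝ) / (k + 1 : ℕ))))⁻¹ := by
    rw [Real.rpow_def_of_pos (by positivity), ← Real.exp_neg, ← inv_div (n : ℝ), Real.log_inv]
    ring_nf
  rw [hb] at h
  rw [hr]
  set M := Real.exp (4 * c1 * Real.log ((n : ℝ) / (k + 1 : ℕ)))
  have hM : 0 < M := Real.exp_pos _
  have h8 : 0 ≤ ((k + 1 : ℕ) : ℝ) ^ (-(1 / 8 : ℝ)) := by positivity
  have hFM : (1 - ζ) / 2 * ((k + 1 : ℕ) : ℝ) * M⁻¹ ≤ F := by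
    rw [← div_eq_mul_inv, div_le_iff₀ hM]
    have : (1 - ζ) * ((k + 1 : ℕ) : ℝ) ≤ (n : ℝ) - k := by
      push_cast at hsn hsltn ⊢
      nlinarith
    linarith
  linarith
end

section
/- In the normal means model, consider the hard thresholding estimator β̂_i(y) = y_i·1(|y_i|² ≥ γ·log(n/s)) with γ > 2, and set α = γ/2 − 1. Then, for true parameter β ∈ B(n,s): (i) FP(β̂) has the Binomial(n − ‖β‖_0, 2Φ(−√(γ log(n/s)))) distribution, where Φ is the standard normal CDF; (ii) for every ζ ∈ (0,1) there exist constants 0 < c < c' (depending only on γ and ζ) such that whenever s/n ≤ ζ and γ·log(n/s) ≥ 1, one has c·s·(s/n)^α/√(log(n/s)) ≤ E_β[FP(β̂)] ≤ c'·s·(s/n)^α/√(log(n/s)). -/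
open MeasureTheory ProbabilityTheory Filter
open scoped ENNReal

/-- Standard normal cumulative distribution function `Φ`. -/
noncomputable def stdGaussCDF (x : ℝ) : ℝ := ((gaussianReal 0 1) (Set.Iic x)).toReal

/-- Hard thresholding estimator `β̂_i(y) = y_i · 1(|y_i|² ≥ γ log(n/s))`. -/
noncomputable def hardThresh (n s : ℕ) (γ : ℝ) : (Fin n → ℝ) → Fin n → ℝ :=
  fun y i => if γ * Real.log ((n : ℝ) / s) ≤ (y i) ^ 2 then y i else 0

theorem gaussianReal_sq_ge_ne_zero (T : ℝ) :
    gaussianReal 0 1 {x | T ≤ x ^ 2 ∧ x ≠ 0} = ENNReal.ofReal (2 * stdGaussCDF (-Real.sqrt T)) := by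
  have := nullSingletonClass_gaussianReal (μ := 0) (v := 1) one_ne_zero
  set t := Real.sqrt T with ht
  have ht0 : 0 ≤ t := Real.sqrt_nonneg T
  have hset : {x : ℝ | T ≤ x ^ 2 ∧ x ≠ 0} = (Set.Iic (-t) ∪ Set.Ici t) \ {0} := by
    ext x
    have : T ≤ x ^ 2 ↔ t ≤ |x| := by
      rw [ht, Real.sqrt_le_left (abs_nonneg x), sq_abs]
    simp only [Set.mem_ofPred_eq, Set.mem_sdiff, Set.mem_union, Set.mem_Iic, Set.mem_Ici,
      Set.mem_singleton_iff, this, le_abs, le_neg]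
    tauto
  have hsym : gaussianReal 0 1 (Set.Ici t) = gaussianReal 0 1 (Set.Iic (-t)) := by
    have h : (gaussianReal 0 1).map (fun x : ℝ => -x) = gaussianReal 0 1 := by
      rw [gaussianReal_map_neg, neg_zero]
    conv_lhs => rw [← h]
    rw [Measure.map_apply measurable_neg measurableSet_Ici]
    congr 1
    ext x
    simp [le_neg]
  have hdisj : AEDisjoint (gaussianReal 0 1) (Set.Iic (-t)) (Set.Ici t) := by
    refine measure_mono_null (t := {0}) ?_ (measure_singleton 0)
    rintro x ⟨h1, h2⟩
    simp only [Set.mem_Iic, Set.mem_Ici] at h1 h2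
    simp only [Set.mem_singleton_iff]
    linarith
  rw [hset, measure_sdiff_null (measure_singleton 0),
    measure_union₀ measurableSet_Ici.nullMeasurableSet hdisj, hsym, stdGaussCDF, two_mul,
    ENNReal.ofReal_add ENNReal.toReal_nonneg ENNReal.toReal_nonneg,
    ENNReal.ofReal_toReal (measure_ne_top _ _)]

theorem stdGaussCDF_neg (t : ℝ) :
    stdGaussCDF (-t) = ∫ x in Set.Ioi t, gaussianPDFReal 0 1 x := by
  have := nullSingletonClass_gaussianReal (μ := 0) (v := 1) one_ne_zero
  rw [stdGaussCDF, gaussianReal_apply_eq_integral _ one_ne_zero, ENNReal.toReal_ofReal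
    (integral_nonneg fun x => gaussianPDFReal_nonneg 0 1 x), ← integral_comp_neg_Ioi]
  refine setIntegral_congr_fun measurableSet_Ioi fun x _ => ?_
  simp [gaussianPDFReal]

theorem stdGaussCDF_neg_le {t : ℝ} (ht : 0 < t) :
    stdGaussCDF (-t) ≤ (Real.sqrt (2 * Real.pi))⁻¹ * Real.exp (-t ^ 2 / 2) / t := by
  rw [stdGaussCDF_neg]
  have hint : ∫ x in Set.Ioi t, Real.exp (-t * x) = Real.exp (-t * t) / t := by
    rw [integral_exp_mul_Ioi (by linarith)]
    ring
  have hle : ∀ x, gaussianPDFReal 0 1 x ≤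
      (Real.sqrt (2 * Real.pi))⁻¹ * Real.exp (t ^ 2 / 2) * Real.exp (-t * x) := by
    intro x
    rw [mul_assoc, ← Real.exp_add]
    simp only [gaussianPDFReal, NNReal.coe_one, mul_one, sub_zero]
    gcongr
    nlinarith [sq_nonneg (x - t)]
  calc ∫ x in Set.Ioi t, gaussianPDFReal 0 1 x
      ≤ ∫ x in Set.Ioi t,
          (Real.sqrt (2 * Real.pi))⁻¹ * Real.exp (t ^ 2 / 2) * Real.exp (-t * x) := by
        refine setIntegral_mono (integrable_gaussianPDFReal 0 1).integrableOn ?_ hle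
        exact (integrableOn_exp_mul_Ioi (by linarith) t).const_mul _
    _ = _ := by
        rw [integral_const_mul, hint, mul_div_assoc', mul_assoc, ← Real.exp_add]
        congr 3
        ring

theorem le_stdGaussCDF_neg {t : ℝ} (ht : 1 ≤ t) :
    Real.exp (-(3 / 2)) * ((Real.sqrt (2 * Real.pi))⁻¹ * Real.exp (-t ^ 2 / 2) / t) ≤
      stdGaussCDF (-t) := by
  have h0 : 0 < t := by linarith
  have h1 : 0 < 1 / t := by positivity
  rw [stdGaussCDF_neg]
  have hint : IntegrableOn (gaussianPDFReal 0 1) (Set.Ioi t) :=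
    (integrable_gaussianPDFReal 0 1).integrableOn
  calc Real.exp (-(3 / 2)) * ((Real.sqrt (2 * Real.pi))⁻¹ * Real.exp (-t ^ 2 / 2) / t)
      = ∫ x in Set.Ioc t (t + 1 / t),
          (Real.sqrt (2 * Real.pi))⁻¹ * Real.exp (-(3 / 2) + -t ^ 2 / 2) := by
        rw [setIntegral_const, Measure.real, Real.volume_Ioc,
          ENNReal.toReal_ofReal (by simpa using h1.le), Real.exp_add, smul_eq_mul]
        ring
    _ ≤ ∫ x in Set.Ioc t (t + 1 / t), gaussianPDFReal 0 1 x := by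
        refine setIntegral_mono_on (integrableOn_const (by simp))
          (hint.mono_set Set.Ioc_subset_Ioi_self) measurableSet_Ioc fun x hx => ?_
        simp only [gaussianPDFReal, NNReal.coe_one, mul_one, sub_zero]
        gcongr
        have hsq : x ^ 2 ≤ (t + 1 / t) ^ 2 := by
          have := hx.1
          have := hx.2
          exact pow_le_pow_left₀ (by linarith) this 2
        have hexp : (t + 1 / t) ^ 2 = t ^ 2 + 2 + (1 / t) ^ 2 := by
          field_simp
          ring
        have : (1 / t) ^ 2 ≤ 1 := by
          rw [div_pow, one_pow, div_le_one (by positivity)]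
          exact one_le_pow₀ ht
        linarith
    _ ≤ ∫ x in Set.Ioi t, gaussianPDFReal 0 1 x :=
        setIntegral_mono_set hint (ae_of_all _ fun x => gaussianPDFReal_nonneg 0 1 x)
          Set.Ioc_subset_Ioi_self.eventuallyLE

/-- Under a product of probability measures, the number of indices in `S` whose coordinate falls in
`A` is binomially distributed when `A` has the same mass `p` in every factor indexed by `S`. -/
theorem pi_card_filter_mem_eq {ι Ω : Type*} [Fintype ι] [MeasurableSpace Ω]
    (μ : ι → Measure Ω) [∀ i, IsProbabilityMeasure (μ i)] (S : Finset ι) {A : Set Ω}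
    [DecidablePred (· ∈ A)] (hA : MeasurableSet A) {p : ℝ≥0∞} (hp : ∀ i ∈ S, μ i A = p) (k : ℕ) :
    Measure.pi μ {y | (S.filter fun i => y i ∈ A).card = k} =
      (S.card.choose k : ℝ≥0∞) * p ^ k * (1 - p) ^ (S.card - k) := by
  classical
  let box : Finset ι → ι → Set Ω := fun U i =>
    if i ∈ U then A else if i ∈ S then Aᶜ else Set.univ
  have hbox : ∀ U i, MeasurableSet (box U i) := by
    intro U i
    simp only [box]
    split_ifs
    exacts [hA, hA.compl, MeasurableSet.univ]
  have hmem : ∀ U ⊆ S, ∀ y : ι → Ω,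
      y ∈ Set.univ.pi (box U) ↔ (S.filter fun i => y i ∈ A) = U := by
    intro U hU y
    simp only [Set.mem_univ_pi, Finset.ext_iff, Finset.mem_filter, box]
    refine forall_congr' fun i => ?_
    have := @hU i
    by_cases hiU : i ∈ U <;> by_cases hiS : i ∈ S <;> simp_all
  have hset : {y : ι → Ω | (S.filter fun i => y i ∈ A).card = k} =
      ⋃ U ∈ S.powersetCard k, Set.univ.pi (box U) := by
    ext y
    simp only [Set.mem_ofPred_eq, Set.mem_iUnion, Finset.mem_powersetCard, exists_prop]
    constructor
    · intro h
      exact ⟨_, ⟨Finset.filter_subset _ S, h⟩, (hmem _ (Finset.filter_subset _ S) y).2 rfl⟩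
    · rintro ⟨U, ⟨hU, hc⟩, hy⟩
      rw [(hmem U hU y).1 hy, hc]
  have hval : ∀ U ∈ S.powersetCard k,
      Measure.pi μ (Set.univ.pi (box U)) = p ^ k * (1 - p) ^ (S.card - k) := by
    intro U hU
    obtain ⟨hUS, hc⟩ := Finset.mem_powersetCard.1 hU
    have h1 : ∀ i ∈ S, μ i (box U i) = if i ∈ U then p else 1 - p := by
      intro i hi
      by_cases hiU : i ∈ U
      · simp [box, hiU, hp i hi]
      · simp [box, hiU, hi, prob_compl_eq_one_sub hA, hp i hi]
    rw [Measure.pi_pi, ← Finset.prod_subset (Finset.subset_univ S), Finset.prod_congr rfl h1,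
      Finset.prod_ite, Finset.prod_const, Finset.prod_const, Finset.filter_mem_eq_inter,
      Finset.inter_eq_right.2 hUS, hc, Finset.filter_notMem_eq_sdiff,
      Finset.card_sdiff_of_subset hUS, hc]
    intro i _ hi
    have : i ∉ U := fun h => hi (hUS h)
    simp [box, hi, this]
  rw [hset, measure_biUnion_finset, Finset.sum_congr rfl hval, Finset.sum_const,
    Finset.card_powersetCard, nsmul_eq_mul, mul_assoc]
  · intro U hU V hV hUV
    refine Set.disjoint_left.2 fun y hyU hyV => hUV ?_
    rw [← (hmem U (Finset.mem_powersetCard.1 hU).1 y).1 hyU,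
      (hmem V (Finset.mem_powersetCard.1 hV).1 y).1 hyV]
  · exact fun U _ => MeasurableSet.univ_pi (hbox U)

/-- Under a product of probability measures, the expected number of indices in `S` whose coordinate
falls in `A`. -/
theorem lintegral_pi_card_filter_mem {ι Ω : Type*} [Fintype ι] [MeasurableSpace Ω]
    (μ : ι → Measure Ω) [∀ i, IsProbabilityMeasure (μ i)] (S : Finset ι) {A : Set Ω}
    [DecidablePred (· ∈ A)] (hA : MeasurableSet A) {p : ℝ≥0∞} (hp : ∀ i ∈ S, μ i A = p) :
    ∫⁻ y, ((S.filter fun i => y i ∈ A).card : ℝ≥0∞) ∂(Measure.pi μ) = S.card * p := by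
  have hpre : ∀ i, MeasurableSet {y : ι → Ω | y i ∈ A} := fun i => measurable_pi_apply i hA
  have h : ∀ y : ι → Ω, ((S.filter fun i => y i ∈ A).card : ℝ≥0∞) =
      ∑ i ∈ S, {y : ι → Ω | y i ∈ A}.indicator 1 y := by
    intro y
    simp [Set.indicator_apply]
  simp_rw [h]
  rw [lintegral_finsetSum _ fun i _ => measurable_one.indicator (hpre i)]
  have h1 : ∀ i ∈ S, ∫⁻ y, {y : ι → Ω | y i ∈ A}.indicator 1 y ∂(Measure.pi μ) = p := by
    intro i hi
    rw [lintegral_indicator_one (hpre i), ← hp i hi]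
    exact (measurePreserving_eval μ i).measure_preimage hA.nullMeasurableSet
  rw [Finset.sum_congr rfl h1, Finset.sum_const, nsmul_eq_mul]

theorem card_filter_eq_zero_eq_sub_ncard {n : ℕ} (β : Fin n → ℝ) :
    (Finset.univ.filter fun i => β i = 0).card = n - {i | β i ≠ 0}.ncard := by
  have h1 : {i | β i ≠ 0}.ncard = (Finset.univ.filter fun i => ¬ β i = 0).card := by
    rw [← Set.ncard_coe_finset]
    simp
  have h2 := Finset.card_filter_add_card_filter_not (s := (Finset.univ : Finset (Fin n)))
    (fun i => β i = 0)
  rw [Finset.card_univ, Fintype.card_fin] at h2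
  omega

theorem FPcount_hardThresh (n s : ℕ) (γ : ℝ) (y β : Fin n → ℝ) :
    FPcount (hardThresh n s γ y) β =
      ((Finset.univ.filter fun i => β i = 0).filter fun i =>
        y i ∈ {x : ℝ | γ * Real.log ((n : ℝ) / s) ≤ x ^ 2 ∧ x ≠ 0}).card := by
  rw [FPcount, ← Set.ncard_coe_finset]
  congr 1
  ext i
  simp only [hardThresh, Set.mem_ofPred_eq, Finset.coe_filter, Finset.mem_filter,
    Finset.mem_univ, true_and]
  split_ifs with h <;> simp [h, and_comm]

theorem measurableSet_sq_ge_ne_zero (T : ℝ) : MeasurableSet {x : ℝ | T ≤ x ^ 2 ∧ x ≠ 0} :=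
  (measurableSet_le measurable_const (measurable_id.pow_const 2)).inter
    (measurableSet_singleton (0 : ℝ)).compl

theorem expFP_hardThresh (n s : ℕ) (γ : ℝ) (β : Fin n → ℝ) :
    expFP n (hardThresh n s γ) β =
      ENNReal.ofReal (((n - {i | β i ≠ 0}.ncard : ℕ) : ℝ) *
        (2 * stdGaussCDF (-Real.sqrt (γ * Real.log ((n : ℝ) / s))))) := by
  simp_rw [expFP, stdNormalMeans, FPcount_hardThresh]
  rw [lintegral_pi_card_filter_mem (fun i => gaussianReal (β i) 1) _
    (measurableSet_sq_ge_ne_zero _)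
    (p := ENNReal.ofReal (2 * stdGaussCDF (-Real.sqrt (γ * Real.log ((n : ℝ) / s))))),
    card_filter_eq_zero_eq_sub_ncard, ENNReal.ofReal_mul (Nat.cast_nonneg _), ENNReal.ofReal_natCast]
  intro i hi
  rw [(Finset.mem_filter.1 hi).2, gaussianReal_sq_ge_ne_zero]

/-- Behavior of the hard thresholding estimator with `γ > 2` and `α = γ/2 − 1`:
(i) `FP(β̂)` is `Binomial(n − ‖β‖₀, 2Φ(−√(γ log(n/s))))`, and
(ii) for every `ζ ∈ (0,1)` there are constants `0 < c < c'` (depending only on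
`γ, ζ`) such that if `s/n ≤ ζ` and `γ log(n/s) ≥ 1` then
`c·s·(s/n)^α/√(log(n/s)) ≤ E_β[FP(β̂)] ≤ c'·s·(s/n)^α/√(log(n/s))`. -/
theorem hardThresh_FP_distribution_and_mean (γ : ℝ) (hγ : 2 < γ) :
    (∀ n s : ℕ, 0 < s → s ≤ n → ∀ β ∈ Sparse n s, ∀ k : ℕ,
      stdNormalMeans n β {y | FPcount (hardThresh n s γ y) β = k} =
        ENNReal.ofReal
          (((n - {i | β i ≠ 0}.ncard).choose k : ℝ)
            * (2 * stdGaussCDF (-Real.sqrt (γ * Real.log ((n : ℝ) / s)))) ^ k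
            * (1 - 2 * stdGaussCDF (-Real.sqrt (γ * Real.log ((n : ℝ) / s))))
                ^ (n - {i | β i ≠ 0}.ncard - k))) ∧
    (∀ ζ ∈ Set.Ioo (0 : ℝ) 1, ∃ c c' : ℝ, 0 < c ∧ c < c' ∧
      ∀ n s : ℕ, 0 < s → ∀ β ∈ Sparse n s, (s : ℝ) / n ≤ ζ →
        1 ≤ γ * Real.log ((n : ℝ) / s) →
        ENNReal.ofReal
            (c * s * ((s : ℝ) / n) ^ (γ / 2 - 1) / Real.sqrt (Real.log ((n : ℝ) / s)))
          ≤ expFP n (hardThresh n s γ) β ∧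
        expFP n (hardThresh n s γ) β ≤
          ENNReal.ofReal
            (c' * s * ((s : ℝ) / n) ^ (γ / 2 - 1) / Real.sqrt (Real.log ((n : ℝ) / s)))) := by
  refine ⟨?_, ?_⟩
  · intro n s _ _ β _ k
    have hp1 : 2 * stdGaussCDF (-Real.sqrt (γ * Real.log ((n : ℝ) / s))) ≤ 1 := by
      rw [← ENNReal.ofReal_le_one, ← gaussianReal_sq_ge_ne_zero]
      exact prob_le_one
    have hp0 : 0 ≤ 2 * stdGaussCDF (-Real.sqrt (γ * Real.log ((n : ℝ) / s))) :=
      mul_nonneg zero_le_two ENNReal.toReal_nonneg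
    simp_rw [stdNormalMeans, FPcount_hardThresh]
    rw [pi_card_filter_mem_eq (fun i => gaussianReal (β i) 1) _ (measurableSet_sq_ge_ne_zero _)
      (p := ENNReal.ofReal (2 * stdGaussCDF (-Real.sqrt (γ * Real.log ((n : ℝ) / s))))),
      card_filter_eq_zero_eq_sub_ncard,
      ENNReal.ofReal_mul (mul_nonneg (Nat.cast_nonneg _) (pow_nonneg hp0 k)),
      ENNReal.ofReal_mul (Nat.cast_nonneg _), ENNReal.ofReal_natCast, ENNReal.ofReal_pow hp0,
      ENNReal.ofReal_pow (by linarith), ENNReal.ofReal_sub _ hp0, ENNReal.ofReal_one]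
    intro i hi
    rw [(Finset.mem_filter.1 hi).2, gaussianReal_sq_ge_ne_zero]
  · rintro ζ ⟨hζ0, hζ1⟩
    have hγ0 : 0 < γ := by linarith
    set K : ℝ := 2 * (Real.sqrt (2 * Real.pi))⁻¹ / Real.sqrt γ with hK
    have hK0 : 0 < K := by positivity
    have he : Real.exp (-(3 / 2)) < 1 := by
      rw [Real.exp_lt_one_iff]
      norm_num
    refine ⟨(1 - ζ) * Real.exp (-(3 / 2)) * K, K,
      mul_pos (mul_pos (by linarith) (Real.exp_pos _)) hK0, ?_, ?_⟩
    · refine mul_lt_of_lt_one_left hK0 ?_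
      nlinarith [Real.exp_pos (-(3 / 2))]
    intro n s hs β hβ hsζ h1
    have hs' : (0 : ℝ) < s := by exact_mod_cast hs
    have hn : (0 : ℝ) < n := by
      rcases Nat.eq_zero_or_pos n with rfl | h
      · norm_num at h1
      · exact_mod_cast h
    have hL : 0 < Real.log ((n : ℝ) / s) := by
      by_contra! h
      nlinarith
    have hr : 0 < (s : ℝ) / n := by positivity
    have hLr : Real.log ((n : ℝ) / s) = -Real.log ((s : ℝ) / n) := by
      rw [← Real.log_inv, inv_div]
    set L := Real.log ((n : ℝ) / s) with hLdef
    have ht1 : 1 ≤ Real.sqrt (γ * L) := Real.one_le_sqrt.2 h1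
    have hexp : Real.exp (-Real.sqrt (γ * L) ^ 2 / 2) = ((s : ℝ) / n) ^ (γ / 2) := by
      rw [Real.sq_sqrt (by linarith), Real.rpow_def_of_pos hr, hLr]
      congr 1
      ring
    have htail : K * s * ((s : ℝ) / n) ^ (γ / 2 - 1) / Real.sqrt L =
        n * (2 * ((Real.sqrt (2 * Real.pi))⁻¹ * Real.exp (-Real.sqrt (γ * L) ^ 2 / 2) /
          Real.sqrt (γ * L))) := by
      rw [hexp, Real.rpow_sub_one hr.ne', Real.sqrt_mul hγ0.le, hK]
      have := Real.sqrt_pos.2 hL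
      field_simp
    have hle := stdGaussCDF_neg_le (zero_lt_one.trans_le ht1)
    have hge := le_stdGaussCDF_neg ht1
    set q := (Real.sqrt (2 * Real.pi))⁻¹ * Real.exp (-Real.sqrt (γ * L) ^ 2 / 2) /
      Real.sqrt (γ * L) with hq
    have hq0 : 0 ≤ q := by positivity
    have hcdf : 0 ≤ stdGaussCDF (-Real.sqrt (γ * L)) := ENNReal.toReal_nonneg
    rw [expFP_hardThresh]
    constructor <;> refine ENNReal.ofReal_le_ofReal ?_
    · have hm : (1 - ζ) * n ≤ ((n - {i | β i ≠ 0}.ncard : ℕ) : ℝ) := by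
        have hβs : (({i | β i ≠ 0}.ncard : ℕ) : ℝ) ≤ s := by exact_mod_cast hβ
        have hsub : (n : ℝ) ≤ ((n - {i | β i ≠ 0}.ncard : ℕ) : ℝ) + {i | β i ≠ 0}.ncard := by
          exact_mod_cast Nat.sub_le_iff_le_add.1 le_rfl
        rw [div_le_iff₀ hn] at hsζ
        linarith
      calc _ = (1 - ζ) * Real.exp (-(3 / 2)) *
              (K * s * ((s : ℝ) / n) ^ (γ / 2 - 1) / Real.sqrt L) := by ring
        _ = (1 - ζ) * n * (2 * (Real.exp (-(3 / 2)) * q)) := by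
            rw [htail]
            ring
        _ ≤ _ := by gcongr
    · rw [htail]
      gcongr
      exact Nat.sub_le _ _
end

section
/- Fix ζ ∈ [0,1) and a positive function t(n,s). Suppose (β̂^{(n)})_n is a sequence of estimators for the normal means model such that each β̂^{(n)} is monotone, and the sequence is selection consistent, i.e., for every sequence β^{(n)} ∈ B(n,s_n) with limsup s_n/n ≤ ζ and ‖β^{(n)}‖_min ≥ t(n,s_n), one has P_{β^{(n)}}(ξ(β̂^{(n)}(y)) = ξ(β^{(n)})) → 1. Then the sequence yields no false discoveries asymptotically: for every sequence β^{(n)} ∈ B(n,s_n) with limsup s_n/n ≤ ζ (no lower bound on nonzero entries assumed), P_{β^{(n)}}(FP(β̂^{(n)}(y)) = 0) → 1. -/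
open MeasureTheory ProbabilityTheory Filter
open scoped ENNReal

/-- `y` majorizes `z`: `sign(y_i)·sign(z_i) ≥ 0` and `|y_i| ≥ |z_i|` for all `i`. -/
def MajorizesVec {n : ℕ} (y z : Fin n → ℝ) : Prop :=
  ∀ i, 0 ≤ Real.sign (y i) * Real.sign (z i) ∧ |z i| ≤ |y i|

/-- A monotone estimator: `β̂(y)` majorizes `β̂(z)` whenever `y` majorizes `z`. -/
def MonotoneEstimator {n : ℕ} (bh : (Fin n → ℝ) → Fin n → ℝ) : Prop :=
  ∀ y z, MajorizesVec y z → MajorizesVec (bh y) (bh z)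

instance stdNormalMeans.instIsProbabilityMeasure (n : ℕ) (β : Fin n → ℝ) :
    IsProbabilityMeasure (stdNormalMeans n β) := by
  unfold stdNormalMeans
  infer_instance

lemma FPcount_eq_zero_iff {n : ℕ} {b β : Fin n → ℝ} :
    FPcount b β = 0 ↔ ∀ i, β i = 0 → b i = 0 := by
  rw [FPcount, Set.ncard_eq_zero, Set.eq_empty_iff_forall_notMem]
  simp only [Set.mem_ofPred_eq, not_and]
  exact forall_congr' fun i => not_imp_not

lemma measurableSet_FPcount_eq_zero {n : ℕ} {bh : (Fin n → ℝ) → Fin n → ℝ} (hbh : Measurable bh)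
    (β : Fin n → ℝ) : MeasurableSet {y | FPcount (bh y) β = 0} := by
  simp only [FPcount_eq_zero_iff, Set.ofPred_forall]
  exact MeasurableSet.iInter fun i => MeasurableSet.iInter fun _ =>
    measurableSet_eq_fun ((measurable_pi_apply i).comp hbh) measurable_const

lemma MajorizesVec.FPcount_ne_zero {n : ℕ} {b b' β : Fin n → ℝ} (h : MajorizesVec b' b)
    (hb : FPcount b β ≠ 0) : FPcount b' β ≠ 0 := by
  rw [Ne, FPcount_eq_zero_iff] at hb ⊢
  refine fun h' => hb fun i hi => ?_
  have := (h i).2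
  rw [h' i hi, abs_zero] at this
  exact abs_nonpos_iff.mp this

/-- Choosing each coordinate from one of two independent vectors with independent coordinates
gives a vector with independent coordinates. -/
lemma map_ite_prod_pi {ι : Type*} [Fintype ι] (p : ι → Prop) [DecidablePred p]
    (μ ν : ι → Measure ℝ) [∀ i, IsProbabilityMeasure (μ i)] [∀ i, IsProbabilityMeasure (ν i)] :
    ((Measure.pi μ).prod (Measure.pi ν)).map (fun x i => if p i then x.1 i else x.2 i) =
      Measure.pi fun i => if p i then μ i else ν i := by
  have : ∀ i, IsProbabilityMeasure (if p i then μ i else ν i) := fun i => by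
    split_ifs <;> infer_instance
  refine (Measure.pi_eq fun s hs => ?_).symm
  have hm : Measurable fun (x : (ι → ℝ) × (ι → ℝ)) i => if p i then x.1 i else x.2 i := by
    refine measurable_pi_lambda _ fun i => ?_
    split_ifs <;> fun_prop
  rw [Measure.map_apply hm (MeasurableSet.univ_pi hs)]
  have hpre : (fun (x : (ι → ℝ) × (ι → ℝ)) i => if p i then x.1 i else x.2 i) ⁻¹'
      Set.univ.pi s = (Set.univ.pi fun i => if p i then s i else Set.univ) ×ˢ
        (Set.univ.pi fun i => if p i then Set.univ else s i) := by
    ext x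
    simp only [Set.mem_preimage, Set.mem_univ_pi, Set.mem_prod, ← forall_and]
    refine forall_congr' fun i => ?_
    by_cases hi : p i <;> simp [hi]
  rw [hpre, Measure.prod_prod, Measure.pi_pi, Measure.pi_pi, ← Finset.prod_mul_distrib]
  refine Finset.prod_congr rfl fun i _ => ?_
  by_cases hi : p i <;> simp [hi]

lemma stdNormalMeans_eq_lintegral {n : ℕ} (p : Fin n → Prop) [DecidablePred p] {β : Fin n → ℝ}
    (hβ : ∀ i, ¬ p i → β i = 0) {E : Set (Fin n → ℝ)} (hE : MeasurableSet E) :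
    stdNormalMeans n β E =
      ∫⁻ u, stdNormalMeans n 0 {v | (fun i => if p i then u i else v i) ∈ E}
        ∂(stdNormalMeans n β) := by
  have hm : Measurable fun (x : (Fin n → ℝ) × (Fin n → ℝ)) i => if p i then x.1 i else x.2 i := by
    refine measurable_pi_lambda _ fun i => ?_
    split_ifs <;> fun_prop
  have hmap : ((stdNormalMeans n β).prod (stdNormalMeans n 0)).map
      (fun x i => if p i then x.1 i else x.2 i) = stdNormalMeans n β := by
    refine (map_ite_prod_pi p _ _).trans ?_
    unfold stdNormalMeans
    congr 1
    funext i
    by_cases hi : p i <;> simp [hi, hβ]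
  nth_rw 1 [← hmap]
  rw [Measure.map_apply hm hE, Measure.prod_apply (hm hE)]
  rfl

lemma stdNormalMeans_closedBall {n : ℕ} (β : Fin n → ℝ) (r : ℝ) :
    stdNormalMeans n β (Metric.closedBall β r) =
      stdNormalMeans n 0 (Metric.closedBall 0 r) := by
  have hmap : (stdNormalMeans n 0).map (fun x i => x i + β i) = stdNormalMeans n β := by
    unfold stdNormalMeans
    rw [Measure.pi_map_pi (f := fun i x => x + β i) fun i => by fun_prop]
    congr 1
    funext i
    simp [gaussianReal_map_add_const]
  rw [← hmap, Measure.map_apply (by fun_prop) Metric.isClosed_closedBall.measurableSet]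
  congr 1
  ext x
  have : (fun i => x i + β i) = x + β := rfl
  simp [this, dist_eq_norm]

lemma exists_le_measure_closedBall {E : Type*} [SeminormedAddCommGroup E] [MeasurableSpace E]
    (μ : Measure E) [IsProbabilityMeasure μ] {c : ℝ≥0∞} (hc : c < 1) :
    ∃ r : ℝ, 0 < r ∧ c ≤ μ (Metric.closedBall 0 r) := by
  have hmono : Monotone fun r : ℝ => Metric.closedBall (0 : E) r :=
    fun _ _ h => Metric.closedBall_subset_closedBall h
  have ht := tendsto_measure_iUnion_atTop (μ := μ) hmono
  have hU : ⋃ r : ℝ, Metric.closedBall (0 : E) r = Set.univ :=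
    Set.eq_univ_of_forall fun x => Set.mem_iUnion.2 ⟨‖x‖, by simp⟩
  rw [hU, measure_univ] at ht
  obtain ⟨r, hr, hr'⟩ := ((eventually_gt_atTop (0 : ℝ)).and (ht.eventually_const_le hc)).exists
  exact ⟨r, hr, hr'⟩

/-- For a monotone estimator, the probability of a false positive is controlled by that at a
parameter with the same support and arbitrarily large nonzero coordinates. -/
lemma MonotoneEstimator.exists_measure_FPcount_le {n : ℕ} {bh : (Fin n → ℝ) → Fin n → ℝ}
    (hmono : MonotoneEstimator bh) (hbh : Measurable bh) (β : Fin n → ℝ) (τ : ℝ)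
    {δ : ℝ≥0∞} (hδ : δ ≠ 0) :
    ∃ β' : Fin n → ℝ, (∀ i, β' i = 0 ↔ β i = 0) ∧ (∀ i, β' i ≠ 0 → τ ≤ |β' i|) ∧
      stdNormalMeans n β {y | FPcount (bh y) β ≠ 0} ≤
        δ + 2 * stdNormalMeans n β' {y | FPcount (bh y) β ≠ 0} := by
  set F : Set (Fin n → ℝ) := {y | FPcount (bh y) β ≠ 0}
  have hFm : MeasurableSet F := (measurableSet_FPcount_eq_zero hbh β).compl
  let g : (Fin n → ℝ) → ℝ≥0∞ := fun u =>
    stdNormalMeans n 0 {v | (fun i => if β i ≠ 0 then u i else v i) ∈ F}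
  have hg {u u' : Fin n → ℝ}
      (h : ∀ i, β i ≠ 0 → 0 ≤ Real.sign (u' i) * Real.sign (u i) ∧ |u i| ≤ |u' i|) :
      g u ≤ g u' := by
    refine measure_mono fun v hv => (hmono _ _ fun i => ?_).FPcount_ne_zero hv
    by_cases hi : β i = 0
    · simp [hi, mul_self_nonneg]
    · simpa [hi] using h i hi
  obtain ⟨A, hA, hAδ⟩ := exists_le_measure_closedBall (stdNormalMeans n β)
    (ENNReal.sub_lt_self ENNReal.one_ne_top one_ne_zero hδ)
  obtain ⟨K, hK, hK2⟩ := exists_le_measure_closedBall (stdNormalMeans n 0)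
    (ENNReal.inv_lt_one.2 ENNReal.one_lt_two)
  let sgn : (Fin n → Bool) → Fin n → ℝ := fun σ i => if σ i then 1 else -1
  obtain ⟨σ, hσ⟩ := Finite.exists_max fun σ => g (A • sgn σ)
  have hsgn (i) : sgn σ i = 1 ∨ sgn σ i = -1 := by
    simp only [sgn]
    split_ifs <;> simp
  let M : ℝ := max (A + K) τ
  have hAM : A + K ≤ M := le_max_left _ _
  have hM0 : 0 < M := by linarith
  let β' : Fin n → ℝ := fun i => if β i = 0 then 0 else M * sgn σ i
  have hsupp (i) : β' i = 0 ↔ β i = 0 := by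
    by_cases hi : β i = 0
    · simp [β', hi]
    · rcases hsgn i with h | h <;> simp [β', hi, h, hM0.ne']
  refine ⟨β', hsupp, fun i hi => ?_, ?_⟩
  · have hi' : β i ≠ 0 := fun h => hi ((hsupp i).2 h)
    rcases hsgn i with h | h <;> simp [β', hi', h, abs_of_pos hM0, M]
  have hle : stdNormalMeans n β F ≤ δ + g (A • sgn σ) := by
    have hball : MeasurableSet (Metric.closedBall (0 : Fin n → ℝ) A) :=
      Metric.isClosed_closedBall.measurableSet
    rw [stdNormalMeans_eq_lintegral (fun i => β i ≠ 0) (fun i => not_not.1) hFm,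
      ← lintegral_add_compl _ hball, add_comm]
    gcongr ?_ + ?_
    · calc ∫⁻ u in (Metric.closedBall 0 A)ᶜ, g u ∂(stdNormalMeans n β)
          ≤ ∫⁻ _ in (Metric.closedBall 0 A)ᶜ, 1 ∂(stdNormalMeans n β) :=
            lintegral_mono fun u => prob_le_one
        _ = 1 - stdNormalMeans n β (Metric.closedBall 0 A) := by
            rw [setLIntegral_one, prob_compl_eq_one_sub hball]
        _ ≤ δ := by
            rw [tsub_le_iff_right]
            exact tsub_le_iff_left.1 hAδ
    · calc ∫⁻ u in Metric.closedBall 0 A, g u ∂(stdNormalMeans n β)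
          ≤ ∫⁻ _ in Metric.closedBall 0 A, g (A • sgn σ) ∂(stdNormalMeans n β) := by
            refine setLIntegral_mono' hball fun u hu => ?_
            refine (hg fun i _ => ?_).trans (hσ fun i => decide (0 ≤ u i))
            have hui : |u i| ≤ A := (norm_le_pi_norm u i).trans (mem_closedBall_zero_iff.1 hu)
            rcases lt_trichotomy (u i) 0 with h | h | h
            · simp [sgn, h.not_ge, Real.sign_of_neg h, Real.sign_of_neg (neg_lt_zero.2 hA),
                abs_of_pos hA, hui]
            · simp [sgn, h, Real.sign_of_pos hA]
            · simp [sgn, h.le, Real.sign_of_pos h, Real.sign_of_pos hA, abs_of_pos hA, hui]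
        _ ≤ g (A • sgn σ) := by
            rw [setLIntegral_const]
            exact mul_le_of_le_one_right' prob_le_one
  have hge : g (A • sgn σ) * 2⁻¹ ≤ stdNormalMeans n β' F := by
    have hball : MeasurableSet (Metric.closedBall β' K) := Metric.isClosed_closedBall.measurableSet
    rw [stdNormalMeans_eq_lintegral (β := β') (fun i => β i ≠ 0)
      (fun i hi => (hsupp i).2 (not_not.1 hi)) hFm]
    calc g (A • sgn σ) * 2⁻¹
        ≤ g (A • sgn σ) * stdNormalMeans n β' (Metric.closedBall β' K) := by
          rw [stdNormalMeans_closedBall]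
          gcongr
      _ = ∫⁻ _ in Metric.closedBall β' K, g (A • sgn σ) ∂(stdNormalMeans n β') := by
          rw [setLIntegral_const]
      _ ≤ ∫⁻ u in Metric.closedBall β' K, g u ∂(stdNormalMeans n β') := by
          refine setLIntegral_mono' hball fun u hu => hg fun i hi => ?_
          have hui : |u i - β' i| ≤ K :=
            (norm_le_pi_norm (u - β') i).trans (mem_closedBall_iff_norm.1 hu)
          rw [abs_le] at hui
          rcases hsgn i with h | h
          · simp only [β', hi, if_false, h, mul_one] at hui
            have hu0 : A ≤ u i := by linarith
            have hu1 : 0 < u i := by linarith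
            simp [h, Real.sign_of_pos hA, Real.sign_of_pos hu1, abs_of_pos hA, abs_of_pos hu1, hu0]
          · simp only [β', hi, if_false, h, mul_neg, mul_one] at hui
            have hu0 : A ≤ -u i := by linarith
            have hu1 : u i < 0 := by linarith
            simp [h, Real.sign_of_neg (neg_lt_zero.2 hA), Real.sign_of_neg hu1, abs_of_pos hA,
              abs_of_neg hu1, hu0]
      _ ≤ ∫⁻ u, g u ∂(stdNormalMeans n β') := setLIntegral_le_lintegral _ _
  refine hle.trans ?_
  gcongr
  rw [mul_comm, ← ENNReal.div_le_iff_le_mul (by simp) (by simp)]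
  exact hge

/-- Lemma 1 of the paper: a monotone, selection-consistent sequence of
estimators (consistency holding for every sparse sequence of parameters whose
nonzero entries exceed the beta-min threshold `t(n, s_n)`) asymptotically makes
no false discoveries, for every sparse sequence of parameters (with no lower
bound assumed on the nonzero entries). -/
theorem monotone_selection_consistent_no_false_positive
    (ζ : ℝ) (hζ : ζ ∈ Set.Ico (0 : ℝ) 1)
    (t : ℕ → ℕ → ℝ) (ht : ∀ n s, 0 < t n s)
    (bh : ∀ n : ℕ, (Fin n → ℝ) → Fin n → ℝ)
    (hmeas : ∀ n, Measurable (bh n))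
    (hmono : ∀ n, MonotoneEstimator (bh n))
    (hconsistent : ∀ (s : ℕ → ℕ) (β : ∀ n : ℕ, Fin n → ℝ),
      (∀ n, β n ∈ Sparse n (s n)) →
      limsup (fun n => (s n : ℝ) / n) atTop ≤ ζ →
      (∀ n i, β n i ≠ 0 → t n (s n) ≤ |β n i|) →
      Tendsto
        (fun n => stdNormalMeans n (β n) {y | {i | bh n y i ≠ 0} = {i | β n i ≠ 0}})
        atTop (nhds 1)) :
    ∀ (s : ℕ → ℕ) (β : ∀ n : ℕ, Fin n → ℝ),
      (∀ n, β n ∈ Sparse n (s n)) →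
      limsup (fun n => (s n : ℝ) / n) atTop ≤ ζ →
      Tendsto (fun n => stdNormalMeans n (β n) {y | FPcount (bh n y) (β n) = 0})
        atTop (nhds 1) := by
  intro s β hβ hs
  have hδ (n : ℕ) : (((n : ℝ≥0∞) + 1)⁻¹) ≠ 0 := by simp
  choose β' hsupp hlarge hle using fun n =>
    (hmono n).exists_measure_FPcount_le (hmeas n) (β n) (t n (s n)) (hδ n)
  have hF (n : ℕ) : MeasurableSet {y | FPcount (bh n y) (β n) = 0} :=
    measurableSet_FPcount_eq_zero (hmeas n) (β n)
  have hsel := hconsistent s β' (fun n => by simpa [Sparse, hsupp] using hβ n) hs hlarge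
  have hβ' : Tendsto (fun n => stdNormalMeans n (β' n) {y | FPcount (bh n y) (β n) = 0})
      atTop (nhds 1) := by
    refine tendsto_of_tendsto_of_tendsto_of_le_of_le hsel tendsto_const_nhds
      (fun n => measure_mono fun y hy => ?_) fun n => prob_le_one
    refine FPcount_eq_zero_iff.2 fun i hi => ?_
    have := (Set.ext_iff.1 hy i).not
    simpa [hsupp, hi] using this
  have hne : Tendsto (fun n => stdNormalMeans n (β' n) {y | FPcount (bh n y) (β n) ≠ 0})
      atTop (nhds 0) := by
    have := ENNReal.Tendsto.sub (tendsto_const_nhds (x := (1 : ℝ≥0∞))) hβ' (by simp)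
    rw [tsub_self] at this
    exact this.congr fun n => (prob_compl_eq_one_sub (hF n)).symm
  have hinv : Tendsto (fun n : ℕ => ((n : ℝ≥0∞) + 1)⁻¹) atTop (nhds 0) := by
    simpa using (tendsto_add_atTop_iff_nat 1).2 ENNReal.tendsto_inv_nat_nhds_zero
  have hbound := hinv.add (ENNReal.Tendsto.const_mul (a := 2) hne (by simp))
  rw [mul_zero, add_zero] at hbound
  have hzero := tendsto_of_tendsto_of_tendsto_of_le_of_le tendsto_const_nhds hbound
    (fun _ => zero_le) hle
  have := ENNReal.Tendsto.sub (tendsto_const_nhds (x := (1 : ℝ≥0∞))) hzero (by simp)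
  rw [tsub_zero] at this
  refine this.congr fun n => ?_
  refine (prob_compl_eq_one_sub (hF n).compl).symm.trans ?_
  rw [compl_compl]
end

section
/- Let (Y, 𝒜) be a measurable space, P_0 a probability measure on it, Θ a set equipped with a probability measure μ and a family (P_θ)_{θ∈Θ} of probability measures on (Y, 𝒜), and let P_μ = ∫ P_θ dμ(θ) be the mixture. Assume P_μ is absolutely continuous with respect to P_0 with density L = dP_μ/dP_0. Let α > 0 and ν ∈ [0, 1−α]. If ∫ L² dP_0 ≤ 1 + 4(1−α−ν)², then for every measurable set A ⊆ Y with P_0(A) ≥ 1−α (the acceptance region of an α-level test), one has sup_{θ∈Θ} P_θ(A) ≥ ν; in fact P_μ(A) ≥ ν. -/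
/-!
Baraud's (2002) testing lower bound: if the mixture P_μ = ∫ P_θ dμ(θ) has
density L w.r.t. P_0 with ∫ L² dP_0 ≤ 1 + 4(1−α−ν)², then every acceptance
region A of an α-level test (P_0(A) ≥ 1−α) satisfies P_μ(A) ≥ ν, and in
particular sup_θ P_θ(A) ≥ ν.
-/

open MeasureTheory
open scoped ENNReal

/-- The total variation distance is at most half the `L²` distance, for a density `f` of mass one:
the variance of `f` dominates `4 * (m(A) - ∫ f over A) ^ 2`. -/
theorem four_mul_sq_measureReal_sub_setIntegral_le {Y : Type*} [MeasurableSpace Y]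
    (m : Measure Y) [IsProbabilityMeasure m] {f : Y → ℝ} (hf : MemLp f 2 m)
    (hf_one : ∫ y, f y ∂m = 1) {A : Set Y} (hA : MeasurableSet A) :
    4 * (m.real A - ∫ y in A, f y ∂m) ^ 2 ≤ ∫ y, f y ^ 2 ∂m - 1 := by
  have hint : Integrable f m := hf.integrable one_le_two
  have hint_sq : Integrable (fun y => f y ^ 2) m := hf.integrable_sq
  have hint_A : Integrable (A.indicator f) m := hint.indicator hA
  have hint_ind : Integrable (A.indicator (1 : Y → ℝ)) m :=
    (integrable_const (1 : ℝ)).indicator hA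
  set d : ℝ := m.real A - ∫ y in A, f y ∂m
  have hpos : 0 ≤ ∫ y, (f y ^ 2 + (-2 - 4 * d) * f y + 8 * d * A.indicator f y
      + (-8 * d) * A.indicator (1 : Y → ℝ) y + (1 + 4 * d + 4 * d ^ 2)) ∂m := by
    refine integral_nonneg fun y => ?_
    by_cases hy : y ∈ A
    · simp only [Set.indicator_of_mem hy, Pi.zero_apply, Pi.one_apply]
      nlinarith [sq_nonneg (f y - 1 + 2 * d)]
    · simp only [Set.indicator_of_notMem hy, Pi.zero_apply]
      nlinarith [sq_nonneg (f y - 1 - 2 * d)]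
  rw [integral_add (by fun_prop) (by fun_prop), integral_add (by fun_prop) (by fun_prop),
    integral_add (by fun_prop) (by fun_prop), integral_add (by fun_prop) (by fun_prop)] at hpos
  simp only [integral_const_mul, integral_indicator hA, hf_one, Pi.one_apply,
    integral_const, probReal_univ, measureReal_restrict_apply_univ, mul_one, one_mul, smul_eq_mul] at hpos
  have hd : d = m.real A - ∫ y in A, f y ∂m := rfl
  linear_combination hpos + 8 * d * hd

theorem baraud_testing_lower_bound
    {Y : Type*} [MeasurableSpace Y] {Θ : Type*} [MeasurableSpace Θ]
    (P0 : Measure Y) [IsProbabilityMeasure P0]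
    (μ : Measure Θ) [IsProbabilityMeasure μ]
    (P : Θ → Measure Y) (hPprob : ∀ θ, IsProbabilityMeasure (P θ))
    (hPmeas : ∀ B : Set Y, MeasurableSet B → Measurable fun θ => P θ B)
    (Pmix : Measure Y)
    (hmix : ∀ B : Set Y, MeasurableSet B → Pmix B = ∫⁻ θ, P θ B ∂μ)
    (L : Y → ℝ≥0∞) (hL : Measurable L)
    (hdensity : ∀ B : Set Y, MeasurableSet B → Pmix B = ∫⁻ y in B, L y ∂P0)
    (α ν : ℝ) (hα : 0 < α) (hν : ν ∈ Set.Icc (0 : ℝ) (1 - α))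
    (hL2 : ∫⁻ y, (L y) ^ 2 ∂P0 ≤ ENNReal.ofReal (1 + 4 * (1 - α - ν) ^ 2))
    (A : Set Y) (hA : MeasurableSet A) (hlevel : ENNReal.ofReal (1 - α) ≤ P0 A) :
    ENNReal.ofReal ν ≤ Pmix A ∧ ENNReal.ofReal ν ≤ ⨆ θ, P θ A := by
  have hL_univ : ∫⁻ y, L y ∂P0 = 1 := by
    rw [← setLIntegral_univ, ← hdensity _ .univ, hmix _ .univ]
    simp
  have hL_fin : ∀ᵐ y ∂P0, L y < ∞ := ae_lt_top hL (by simp [hL_univ])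
  have hset (B : Set Y) (hB : MeasurableSet B) : ∫ y in B, (L y).toReal ∂P0 = (Pmix B).toReal := by
    rw [integral_toReal hL.aemeasurable (ae_restrict_of_ae hL_fin), hdensity B hB]
  have hone : ∫ y, (L y).toReal ∂P0 = 1 := by
    rw [integral_toReal hL.aemeasurable hL_fin, hL_univ, ENNReal.toReal_one]
  have hL2_fin : ∫⁻ y, L y ^ 2 ∂P0 ≠ ∞ := (hL2.trans_lt ENNReal.ofReal_lt_top).ne
  have hmem : MemLp (fun y => (L y).toReal) 2 P0 := by
    rw [memLp_two_iff_integrable_sq hL.ennreal_toReal.aestronglyMeasurable]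
    simpa only [ENNReal.toReal_pow] using
      integrable_toReal_of_lintegral_ne_top (hL.pow_const 2).aemeasurable hL2_fin
  have hsq : ∫ y, (L y).toReal ^ 2 ∂P0 ≤ 1 + 4 * (1 - α - ν) ^ 2 := by
    simp only [← ENNReal.toReal_pow]
    rw [integral_toReal (hL.pow_const 2).aemeasurable (ae_lt_top (hL.pow_const 2) hL2_fin)]
    exact ENNReal.toReal_le_of_le_ofReal (by positivity) hL2
  have hkey := four_mul_sq_measureReal_sub_setIntegral_le P0 hmem hone hA
  rw [hset A hA] at hkey
  have hlevel_real : 1 - α ≤ P0.real A :=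
    (ENNReal.ofReal_le_iff_le_toReal (measure_ne_top P0 A)).1 hlevel
  have hdiff : P0.real A - (Pmix A).toReal ≤ 1 - α - ν :=
    le_of_abs_le (abs_le_of_sq_le_sq (by linarith) (by linarith [hν.2]))
  have hmix_le : ENNReal.ofReal ν ≤ Pmix A :=
    ENNReal.ofReal_le_of_le_toReal (by linarith)
  refine ⟨hmix_le, hmix_le.trans ?_⟩
  rw [hmix A hA]
  calc ∫⁻ θ, P θ A ∂μ ≤ ∫⁻ _, ⨆ θ, P θ A ∂μ := lintegral_mono fun θ => le_iSup (fun θ => P θ A) θ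
    _ = ⨆ θ, P θ A := by simp
end

section
/- Let d ≥ 1, let Z = (Z_1, …, Z_d) have i.i.d. standard normal coordinates, and let μ ∈ ℝ^d with κ = ‖μ‖². Then the noncentral chi-square variable ‖Z + μ‖² satisfies, for every x > 0: (i) P(‖Z + μ‖² > d + κ + 2x + √((4d + 8κ)·x)) ≤ exp(−x), and (ii) P(‖Z + μ‖² < d + κ − √((4d + 8κ)·x)) ≤ exp(−x). -/
/-!
Laurent–Massart-type concentration for noncentral chi-square:
if Z has i.i.d. standard normal coordinates and κ = ‖μ‖², then ‖Z + μ‖²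
concentrates around d + κ.
-/

open MeasureTheory ProbabilityTheory

/-- The moment generating function of the noncentral chi-square distribution with one degree of
freedom. -/
theorem integral_exp_mul_add_sq_gaussianReal {t : ℝ} (ht : t < 1 / 2) (m : ℝ) :
    ∫ z, Real.exp (t * (z + m) ^ 2) ∂(gaussianReal 0 1)
      = (√(1 - 2 * t))⁻¹ * Real.exp (t * m ^ 2 / (1 - 2 * t)) := by
  have h0 : 0 < 1 - 2 * t := by linarith
  have hne : 1 - 2 * t ≠ 0 := h0.ne'
  have hsq : ∀ z : ℝ, gaussianPDFReal 0 1 z • Real.exp (t * (z + m) ^ 2)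
      = ((√(2 * Real.pi))⁻¹ * Real.exp (t * m ^ 2 / (1 - 2 * t)))
        * Real.exp (-(1 / 2 - t) * (z - 2 * t * m / (1 - 2 * t)) ^ 2) := by
    intro z
    rw [gaussianPDFReal, smul_eq_mul, mul_assoc,
      mul_assoc (√(2 * Real.pi))⁻¹, ← Real.exp_add, ← Real.exp_add]
    congr 2
    · simp
    · push_cast
      field_simp
      ring
  rw [integral_gaussianReal_eq_integral_smul one_ne_zero]
  simp_rw [hsq]
  rw [integral_const_mul,
    integral_sub_right_eq_self (fun z : ℝ => Real.exp (-(1 / 2 - t) * z ^ 2)),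
    integral_gaussian, show Real.pi / (1 / 2 - t) = 2 * Real.pi / (1 - 2 * t) by
      field_simp, Real.sqrt_div (by positivity)]
  have : √(2 * Real.pi) ≠ 0 := by positivity
  field_simp

/-- The moment generating function of the noncentral chi-square distribution. -/
theorem mgf_sum_add_sq_gaussianReal {ι : Type*} [Fintype ι] {t : ℝ} (ht : t < 1 / 2)
    (μ : ι → ℝ) :
    mgf (fun z : ι → ℝ => ∑ i, (z i + μ i) ^ 2) (Measure.pi fun _ => gaussianReal 0 1) t
      = (√(1 - 2 * t))⁻¹ ^ Fintype.card ι
        * Real.exp (t * (∑ i, μ i ^ 2) / (1 - 2 * t)) := by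
  simp_rw [mgf, Finset.mul_sum, Real.exp_sum]
  rw [integral_fintype_prod_eq_prod (fun i z => Real.exp (t * (z + μ i) ^ 2))]
  simp_rw [integral_exp_mul_add_sq_gaussianReal ht]
  rw [Finset.prod_mul_distrib, ← Real.exp_sum, Finset.prod_const, Finset.card_univ,
    Finset.sum_div]

theorem integrable_exp_mul_sum_add_sq_gaussianReal {ι : Type*} [Fintype ι] {t : ℝ}
    (ht : t < 1 / 2) (μ : ι → ℝ) :
    Integrable (fun z : ι → ℝ => Real.exp (t * ∑ i, (z i + μ i) ^ 2))
      (Measure.pi fun _ => gaussianReal 0 1) := by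
  by_contra h
  have h0 : 0 < 1 - 2 * t := by linarith
  have h1 := mgf_sum_add_sq_gaussianReal ht μ
  rw [mgf_undef h] at h1
  have : 0 < (√(1 - 2 * t))⁻¹ ^ Fintype.card ι
        * Real.exp (t * (∑ i, μ i ^ 2) / (1 - 2 * t)) := by positivity
  exact this.ne h1

theorem inv_sqrt_one_sub_le_exp {t : ℝ} (ht0 : 0 ≤ t) (ht : t < 1 / 2) :
    (√(1 - 2 * t))⁻¹ ≤ Real.exp (t + t ^ 2 / (1 - 2 * t)) := by
  have h0 : 0 < 1 - 2 * t := by linarith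
  have hne : 1 - 2 * t ≠ 0 := h0.ne'
  have h1 : 0 ≤ Real.log (1 - 2 * t)⁻¹ :=
    Real.log_nonneg ((one_le_inv₀ h0).2 (by linarith))
  have h2 := Real.self_le_sinh_iff.2 h1
  rw [Real.sinh_log (by positivity), Real.log_inv] at h2
  rw [← Real.log_le_iff_le_exp (by positivity), Real.log_inv, Real.log_sqrt h0.le]
  have h3 : t + t ^ 2 / (1 - 2 * t) = ((1 - 2 * t)⁻¹ - (1 - 2 * t)⁻¹⁻¹) / 2 / 2 := by
    obtain ⟨w, rfl⟩ : ∃ w, t = (1 - w) / 2 := ⟨1 - 2 * t, by ring⟩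
    rw [show 1 - 2 * ((1 - w) / 2) = w by ring] at hne ⊢
    field_simp
    ring
  linarith

theorem inv_sqrt_one_add_le_exp {u : ℝ} (hu : 0 ≤ u) :
    (√(1 + 2 * u))⁻¹ ≤ Real.exp (-u + u ^ 2) := by
  have h0 : 0 < 1 + 2 * u := by linarith
  rw [← Real.log_le_iff_le_exp (by positivity), Real.log_inv, Real.log_sqrt h0.le]
  have h1 := Real.le_log_one_add_of_nonneg (x := 2 * u) (by positivity)
  have h2 : 2 * u - 2 * u ^ 2 ≤ 2 * (2 * u) / (2 * u + 2) := by
    rw [le_div_iff₀ (by positivity)]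
    nlinarith [pow_nonneg hu 3]
  linarith

theorem mgf_sum_add_sq_gaussianReal_le {ι : Type*} [Fintype ι] {t : ℝ} (ht0 : 0 ≤ t)
    (ht : t < 1 / 2) (μ : ι → ℝ) :
    mgf (fun z : ι → ℝ => ∑ i, (z i + μ i) ^ 2) (Measure.pi fun _ => gaussianReal 0 1) t
      ≤ Real.exp (t * (Fintype.card ι + ∑ i, μ i ^ 2)
        + (Fintype.card ι + 2 * ∑ i, μ i ^ 2) * (t ^ 2 / (1 - 2 * t))) := by
  have h0 : 0 < 1 - 2 * t := by linarith
  have hne : 1 - 2 * t ≠ 0 := h0.ne'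
  rw [mgf_sum_add_sq_gaussianReal ht]
  calc _ ≤ Real.exp (t + t ^ 2 / (1 - 2 * t)) ^ Fintype.card ι
        * Real.exp (t * (∑ i, μ i ^ 2) / (1 - 2 * t)) := by
        gcongr
        exact inv_sqrt_one_sub_le_exp ht0 ht
    _ = _ := by
        rw [← Real.exp_nat_mul, ← Real.exp_add]
        congr 1
        obtain ⟨w, rfl⟩ : ∃ w, t = (1 - w) / 2 := ⟨1 - 2 * t, by ring⟩
        rw [show 1 - 2 * ((1 - w) / 2) = w by ring] at hne ⊢
        field_simp
        ring

theorem mgf_neg_sum_add_sq_gaussianReal_le {ι : Type*} [Fintype ι] {u : ℝ} (hu : 0 ≤ u)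
    (μ : ι → ℝ) :
    mgf (fun z : ι → ℝ => ∑ i, (z i + μ i) ^ 2) (Measure.pi fun _ => gaussianReal 0 1) (-u)
      ≤ Real.exp (-u * (Fintype.card ι + ∑ i, μ i ^ 2)
        + (Fintype.card ι + 2 * ∑ i, μ i ^ 2) * u ^ 2) := by
  have h0 : 0 < 1 + 2 * u := by linarith
  have hk : 0 ≤ ∑ i, μ i ^ 2 := Finset.sum_nonneg fun i _ => sq_nonneg _
  rw [mgf_sum_add_sq_gaussianReal (by linarith), show 1 - 2 * -u = 1 + 2 * u by ring]
  have h1 : -u * (∑ i, μ i ^ 2) / (1 + 2 * u)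
      ≤ -u * (∑ i, μ i ^ 2) + 2 * (∑ i, μ i ^ 2) * u ^ 2 := by
    rw [div_le_iff₀ h0]
    have : 0 ≤ (∑ i, μ i ^ 2) * u ^ 3 := by positivity
    nlinarith
  calc _ ≤ Real.exp (-u + u ^ 2) ^ Fintype.card ι
        * Real.exp (-u * (∑ i, μ i ^ 2) + 2 * (∑ i, μ i ^ 2) * u ^ 2) := by
        gcongr
        exact inv_sqrt_one_add_le_exp hu
    _ = _ := by
        rw [← Real.exp_nat_mul, ← Real.exp_add]
        congr 1
        ring

theorem noncentral_chisq_concentration (d : ℕ) (hd : 1 ≤ d) (μ : Fin d → ℝ)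
    (x : ℝ) (hx : 0 < x) :
    (Measure.pi fun _ : Fin d => gaussianReal 0 1)
        {z : Fin d → ℝ |
          (d : ℝ) + (∑ i, (μ i) ^ 2) + 2 * x
            + Real.sqrt ((4 * d + 8 * (∑ i, (μ i) ^ 2)) * x) < ∑ i, (z i + μ i) ^ 2}
      ≤ ENNReal.ofReal (Real.exp (-x)) ∧
    (Measure.pi fun _ : Fin d => gaussianReal 0 1)
        {z : Fin d → ℝ |
          ∑ i, (z i + μ i) ^ 2 <
            (d : ℝ) + (∑ i, (μ i) ^ 2)
              - Real.sqrt ((4 * d + 8 * (∑ i, (μ i) ^ 2)) * x)}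
      ≤ ENNReal.ofReal (Real.exp (-x)) := by
  have hk : 0 ≤ ∑ i, (μ i) ^ 2 := Finset.sum_nonneg fun i _ => sq_nonneg _
  have hd' : (1 : ℝ) ≤ d := by exact_mod_cast hd
  set κ := ∑ i, (μ i) ^ 2 with hκ
  obtain ⟨v, hv, hvV⟩ : ∃ v : ℝ, 0 < v ∧ v ^ 2 = d + 2 * κ :=
    ⟨√(d + 2 * κ), by positivity, Real.sq_sqrt (by positivity)⟩
  obtain ⟨s, hs, rfl⟩ : ∃ s : ℝ, 0 < s ∧ s ^ 2 = x :=
    ⟨√x, by positivity, Real.sq_sqrt hx.le⟩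
  have hsqrt : √((4 * d + 8 * κ) * s ^ 2) = 2 * v * s := by
    rw [show (4 * d + 8 * κ) * s ^ 2 = (2 * v * s) ^ 2 by
      linear_combination (-4 * s ^ 2) * hvV]
    exact Real.sqrt_sq (by positivity)
  rw [hsqrt]
  constructor
  · have ht0 : 0 ≤ s / (v + 2 * s) := by positivity
    have ht : s / (v + 2 * s) < 1 / 2 := by
      rw [div_lt_div_iff₀ (by positivity) two_pos]
      linarith
    refine (measure_mono (Set.ofPred_subset_ofPred.2 fun z hz => hz.le)).trans ?_
    rw [← ofReal_measureReal]
    refine ENNReal.ofReal_le_ofReal ((measure_ge_le_exp_mul_mgf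
      (X := fun z : Fin d → ℝ => ∑ i, (z i + μ i) ^ 2) _ ht0
      (integrable_exp_mul_sum_add_sq_gaussianReal ht μ)).trans ?_)
    refine (mul_le_mul_of_nonneg_left (mgf_sum_add_sq_gaussianReal_le ht0 ht μ)
      (Real.exp_pos _).le).trans_eq ?_
    rw [← Real.exp_add, Fintype.card_fin, ← hκ, ← hvV,
      show 1 - 2 * (s / (v + 2 * s)) = v / (v + 2 * s) by field_simp; ring]
    congr 1
    field_simp
    ring
  · have hu : 0 ≤ s / v := by positivity
    refine (measure_mono (Set.ofPred_subset_ofPred.2 fun z hz => hz.le)).trans ?_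
    rw [← ofReal_measureReal]
    refine ENNReal.ofReal_le_ofReal ((measure_le_le_exp_mul_mgf
      (X := fun z : Fin d → ℝ => ∑ i, (z i + μ i) ^ 2) _ (neg_nonpos.2 hu)
      (integrable_exp_mul_sum_add_sq_gaussianReal (by linarith) μ)).trans ?_)
    refine (mul_le_mul_of_nonneg_left (mgf_neg_sum_add_sq_gaussianReal_le hu μ)
      (Real.exp_pos _).le).trans_eq ?_
    rw [← Real.exp_add, Fintype.card_fin, ← hκ, ← hvV]
    congr 1
    field_simp
    ring
end
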